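/- Deviation between partial-participation and full-participation aggregates (the bound (eq. server-strong-partial-1)). In one round of parallel local SGD with N clients, τ steps, step size η ≥ 0, common initial point x⁰ and participation indicators I_1,…,I_N, one has 𝔼[‖η·∑_{n=1}^N a_n·(I_n/q_n − 1)·∑_{i=0}^{τ−1} g_n(X_{n,i}, ω_{n,i})‖²] ≤ N·τ²·η²·G²·∑_{n=1}^N a_n²/q_n. -/

import Mathlib

open MeasureTheory
open scoped RealInnerProductSpace

/-- Resampling one coordinate of a product measure preserves the measure. -/
lemma measurePreserving_update {ι : Type*} [Fintype ι] [DecidableEq ι] {α : ι → Type*}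
    [∀ i, MeasurableSpace (α i)] (μ : ∀ i, Measure (α i)) [∀ i, IsProbabilityMeasure (μ i)]
    (i : ι) :
    MeasurePreserving (fun p : (∀ j, α j) × α i => Function.update p.1 i p.2)
      ((Measure.pi μ).prod (μ i)) (Measure.pi μ) := by
  refine ⟨measurable_update', ?_⟩
  symm
  refine Measure.pi_eq fun s hs => ?_
  rw [Measure.map_apply measurable_update' (MeasurableSet.univ_pi hs)]
  have hpre : (fun p : (∀ j, α j) × α i => Function.update p.1 i p.2) ⁻¹' Set.univ.pi s
      = (Set.univ.pi (Function.update s i Set.univ)) ×ˢ s i := by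
    ext p
    simp only [Set.mem_preimage, Set.mem_univ_pi, Set.mem_prod]
    constructor
    · intro h
      refine ⟨fun j => ?_, by simpa using h i⟩
      by_cases hj : j = i
      · subst hj; simp
      · simpa [hj] using h j
    · rintro ⟨h, hi⟩ j
      by_cases hj : j = i
      · subst hj; simpa using hi
      · simpa [hj] using h j
  rw [hpre, Measure.prod_prod, Measure.pi_pi, ← Finset.prod_erase_mul _ _ (Finset.mem_univ i),
    ← Finset.prod_erase_mul Finset.univ (fun j => μ j (s j)) (Finset.mem_univ i)]
  simp only [Function.update_self, measure_univ, mul_one]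
  congr 1
  refine Finset.prod_congr rfl fun j hj => ?_
  rw [Function.update_of_ne (Finset.ne_of_mem_erase hj)]

/-- Resampling one coordinate of a product of product measures preserves the measure. -/
lemma measurePreserving_update_update {ι κ : Type*} [Fintype ι] [DecidableEq ι] [Fintype κ]
    [DecidableEq κ] {α : ι → Type*} [∀ i, MeasurableSpace (α i)] (μ : ∀ i, Measure (α i))
    [∀ i, IsProbabilityMeasure (μ i)] (i : ι) (k : κ) :
    MeasurePreserving
      (fun p : (∀ j, κ → α j) × α i => Function.update p.1 i (Function.update (p.1 i) k p.2))
      ((Measure.pi fun j => Measure.pi fun _ : κ => μ j).prod (μ i))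
      (Measure.pi fun j => Measure.pi fun _ : κ => μ j) := by
  have hu := measurePreserving_update (fun j => Measure.pi fun _ : κ => μ j) i
  have hv := measurePreserving_update (fun _ : κ => μ i) k
  have hmeas : Measurable (fun p : (∀ j, κ → α j) × α i =>
      Function.update p.1 i (Function.update (p.1 i) k p.2)) :=
    hu.measurable.comp (measurable_fst.prodMk
      (hv.measurable.comp (((measurable_pi_apply i).comp measurable_fst).prodMk measurable_snd)))
  have hleft := hu.prod (MeasurePreserving.id (μ i))
  have hright := (hu.comp ((MeasurePreserving.id
    (Measure.pi fun j => Measure.pi fun _ : κ => μ j)).prod hv)).comp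
    (measurePreserving_prodAssoc (Measure.pi fun j => Measure.pi fun _ : κ => μ j)
      (Measure.pi fun _ : κ => μ i) (μ i))
  refine ⟨hmeas, Eq.trans ?_ hright.map_eq⟩
  rw [← hleft.map_eq, Measure.map_map hmeas hleft.measurable]
  congr 1
  funext p
  simp [MeasurableEquiv.prodAssoc]

lemma ofReal_norm_sq_le_of_add {E : Type*} [NormedAddCommGroup E] (u v : E) :
    ENNReal.ofReal (‖v‖ ^ 2) ≤
      2 * ENNReal.ofReal (‖u + v‖ ^ 2) + 2 * ENNReal.ofReal (‖u‖ ^ 2) := by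
  rw [show (2 : ENNReal) = ENNReal.ofReal 2 by simp, ← ENNReal.ofReal_mul (by norm_num),
    ← ENNReal.ofReal_mul (by norm_num), ← ENNReal.ofReal_add (by positivity) (by positivity)]
  apply ENNReal.ofReal_le_ofReal
  have h : ‖v‖ ≤ ‖u + v‖ + ‖u‖ := by simpa using norm_sub_le (u + v) u
  nlinarith [sq_nonneg (‖u + v‖ - ‖u‖), norm_nonneg v, norm_nonneg u, norm_nonneg (u + v)]

section LocalSGD

variable {E : Type*} [NormedAddCommGroup E] [InnerProductSpace ℝ E] {Z : Type*} {τ : ℕ}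

/-- The iterates of local SGD as functions of the oracle samples of a single client, frozen after
`τ` steps. -/
def localSGD (g : E → Z → E) (η : ℝ) (x0 : E) (y : Fin τ → Z) : ℕ → E
  | 0 => x0
  | k + 1 => if h : k < τ then
      localSGD g η x0 y k - η • g (localSGD g η x0 y k) (y ⟨k, h⟩)
    else localSGD g η x0 y k

lemma localSGD_update (g : E → Z → E) (η : ℝ) (x0 : E) (y : Fin τ → Z) (k : Fin τ) (z : Z)
    {j : ℕ} (hj : j ≤ k) :
    localSGD g η x0 (Function.update y k z) j = localSGD g η x0 y j := by
  induction j with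
  | zero => rfl
  | succ j ih =>
    have hjτ : j < τ := by omega
    have hne : (⟨j, hjτ⟩ : Fin τ) ≠ k := fun h => by
      have := congrArg Fin.val h
      simp at this
      omega
    simp only [localSGD, hjτ, dite_true, ih (by omega), Function.update_of_ne hne]

/-- The sum of the first `k` stochastic gradients along local SGD. -/
def gradSum (g : E → Z → E) (η : ℝ) (x0 : E) (k : ℕ) (y : Fin τ → Z) : E :=
  ∑ i : Fin τ, if (i : ℕ) < k then g (localSGD g η x0 y i) (y i) else 0

lemma gradSum_self (g : E → Z → E) (η : ℝ) (x0 : E) (y : Fin τ → Z) :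
    gradSum g η x0 τ y = ∑ i : Fin τ, g (localSGD g η x0 y i) (y i) := by
  simp [gradSum]

lemma gradSum_succ_update (g : E → Z → E) (η : ℝ) (x0 : E) (y : Fin τ → Z) (k : Fin τ) (z : Z) :
    gradSum g η x0 (k + 1) (Function.update y k z)
      = gradSum g η x0 k y + g (localSGD g η x0 y k) z := by
  unfold gradSum
  rw [← Finset.sum_erase_add _ _ (Finset.mem_univ k),
    ← Finset.sum_erase_add (a := k) _ (fun i : Fin τ =>
      if (i : ℕ) < k then g (localSGD g η x0 y i) (y i) else 0) (Finset.mem_univ k)]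
  simp only [Nat.lt_succ_self, if_true, lt_irrefl, if_false, add_zero, Function.update_self,
    localSGD_update g η x0 y k z le_rfl]
  congr 1
  refine Finset.sum_congr rfl fun i hi => ?_
  have hne := Finset.ne_of_mem_erase hi
  have hval : (i : ℕ) ≠ k := fun h => hne (Fin.ext h)
  by_cases h : (i : ℕ) < k
  · rw [if_pos h, if_pos (by omega), localSGD_update g η x0 y k z h.le,
      Function.update_of_ne hne]
  · rw [if_neg h, if_neg (by omega)]

variable [MeasurableSpace E] [BorelSpace E] [MeasurableSpace Z]

/-- If the gradient sum over the first `k + 1` steps is dominated in square by an integrable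
function, then the oracle at the `k`-th iterate almost surely has a finite second moment, and the
sum over the first `k` steps is dominated as well. -/
lemma gradSum_dominated_step (ν : Measure Z) [IsProbabilityMeasure ν] (g : E → Z → E)
    (hg : ∀ x, Measurable (g x)) (η : ℝ) (x0 : E) {K : ENNReal} (hK : K ≠ ⊤)
    (hgK : ∀ x, ∫⁻ z, ENNReal.ofReal (‖g x z‖ ^ 2) ∂ν ≠ ⊤ →
      ∫⁻ z, ENNReal.ofReal (‖g x z‖ ^ 2) ∂ν ≤ K)
    (k : Fin τ) {ψ : (Fin τ → Z) → ENNReal} (hψ : Measurable ψ)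
    (hfin : ∫⁻ y, ψ y ∂(Measure.pi fun _ : Fin τ => ν) ≠ ⊤)
    (hle : ∀ᵐ y ∂(Measure.pi fun _ : Fin τ => ν),
      ENNReal.ofReal (‖gradSum g η x0 (k + 1) y‖ ^ 2) ≤ ψ y) :
    (∀ᵐ y ∂(Measure.pi fun _ : Fin τ => ν),
      ∫⁻ z, ENNReal.ofReal (‖g (localSGD g η x0 y k) z‖ ^ 2) ∂ν ≠ ⊤) ∧
    ∃ φ : (Fin τ → Z) → ENNReal, Measurable φ ∧
      ∫⁻ y, φ y ∂(Measure.pi fun _ : Fin τ => ν) ≠ ⊤ ∧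
      ∀ᵐ y ∂(Measure.pi fun _ : Fin τ => ν),
        ENNReal.ofReal (‖gradSum g η x0 k y‖ ^ 2) ≤ φ y := by
  have hmp := measurePreserving_update (fun _ : Fin τ => ν) k
  have hψm := hψ.comp hmp.measurable
  have hintegrable : ∫⁻ y, ∫⁻ z, ψ (Function.update y k z) ∂ν ∂(Measure.pi fun _ : Fin τ => ν)
      = ∫⁻ y, ψ y ∂(Measure.pi fun _ : Fin τ => ν) := by
    rw [← hmp.lintegral_comp hψ]
    exact (lintegral_prod _ hψm.aemeasurable).symm
  have hout : Measurable fun y : Fin τ → Z => ∫⁻ z, ψ (Function.update y k z) ∂ν :=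
    hψm.lintegral_prod_right'
  have hlt := ae_lt_top hout (hintegrable ▸ hfin)
  have hae := Measure.ae_ae_of_ae_prod (hmp.quasiMeasurePreserving.ae hle)
  have hsq : ∀ x, Measurable fun z => ENNReal.ofReal (‖g x z‖ ^ 2) := fun x =>
    ((hg x).norm.pow_const 2).ennreal_ofReal
  have hmom : ∀ᵐ y ∂(Measure.pi fun _ : Fin τ => ν),
      ∫⁻ z, ENNReal.ofReal (‖g (localSGD g η x0 y k) z‖ ^ 2) ∂ν ≠ ⊤ := by
    filter_upwards [hlt, hae] with y h1 h2
    have hbd : ∫⁻ z, ENNReal.ofReal (‖g (localSGD g η x0 y k) z‖ ^ 2) ∂ν ≤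
        ∫⁻ z, (2 * ψ (Function.update y k z)
          + 2 * ENNReal.ofReal (‖gradSum g η x0 k y‖ ^ 2)) ∂ν := by
      refine lintegral_mono_ae ?_
      filter_upwards [h2] with z hz
      rw [gradSum_succ_update] at hz
      refine (ofReal_norm_sq_le_of_add (gradSum g η x0 k y) _).trans ?_
      gcongr
    refine ne_top_of_le_ne_top ?_ hbd
    rw [lintegral_add_right _ measurable_const, lintegral_const_mul' _ _ (by simp)]
    simp [ENNReal.mul_eq_top, h1.ne]
  refine ⟨hmom, fun y => 2 * ∫⁻ z, ψ (Function.update y k z) ∂ν + 2 * K,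
    (hout.const_mul 2).add_const _, ?_, ?_⟩
  · rw [lintegral_add_right _ measurable_const, lintegral_const_mul' _ _ (by simp), hintegrable]
    simp [ENNReal.mul_eq_top, hfin, hK]
  · filter_upwards [hmom, hae] with y h1 h2
    calc ENNReal.ofReal (‖gradSum g η x0 k y‖ ^ 2)
        = ∫⁻ _, ENNReal.ofReal (‖gradSum g η x0 k y‖ ^ 2) ∂ν := by simp
      _ ≤ ∫⁻ z, (2 * ψ (Function.update y k z)
            + 2 * ENNReal.ofReal (‖g (localSGD g η x0 y k) z‖ ^ 2)) ∂ν := by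
          refine lintegral_mono_ae ?_
          filter_upwards [h2] with z hz
          rw [gradSum_succ_update, add_comm] at hz
          refine (ofReal_norm_sq_le_of_add (g (localSGD g η x0 y k) z) _).trans ?_
          gcongr
      _ ≤ _ := by
          rw [lintegral_add_right _ ((hsq _).const_mul 2), lintegral_const_mul' _ _ (by simp),
            lintegral_const_mul' _ _ (by simp)]
          gcongr
          exact hgK _ h1

/-- If the total gradient sum is dominated in square by an integrable function, then along local
SGD the oracle almost surely has a finite second moment. -/
lemma ae_secondMoment_ne_top (ν : Measure Z) [IsProbabilityMeasure ν] (g : E → Z → E)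
    (hg : ∀ x, Measurable (g x)) (η : ℝ) (x0 : E) {K : ENNReal} (hK : K ≠ ⊤)
    (hgK : ∀ x, ∫⁻ z, ENNReal.ofReal (‖g x z‖ ^ 2) ∂ν ≠ ⊤ →
      ∫⁻ z, ENNReal.ofReal (‖g x z‖ ^ 2) ∂ν ≤ K)
    {ψ : (Fin τ → Z) → ENNReal} (hψ : Measurable ψ)
    (hfin : ∫⁻ y, ψ y ∂(Measure.pi fun _ : Fin τ => ν) ≠ ⊤)
    (hle : ∀ᵐ y ∂(Measure.pi fun _ : Fin τ => ν),
      ENNReal.ofReal (‖gradSum g η x0 τ y‖ ^ 2) ≤ ψ y) (k : Fin τ) :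
    ∀ᵐ y ∂(Measure.pi fun _ : Fin τ => ν),
      ∫⁻ z, ENNReal.ofReal (‖g (localSGD g η x0 y k) z‖ ^ 2) ∂ν ≠ ⊤ := by
  have hdom : ∀ j ≤ τ, ∃ φ : (Fin τ → Z) → ENNReal, Measurable φ ∧
      ∫⁻ y, φ y ∂(Measure.pi fun _ : Fin τ => ν) ≠ ⊤ ∧
      ∀ᵐ y ∂(Measure.pi fun _ : Fin τ => ν),
        ENNReal.ofReal (‖gradSum g η x0 j y‖ ^ 2) ≤ φ y := by
    intro j hj
    induction hj using Nat.decreasingInduction with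
    | self => exact ⟨ψ, hψ, hfin, hle⟩
    | of_succ j hj ih =>
      obtain ⟨φ, h1, h2, h3⟩ := ih
      exact (gradSum_dominated_step ν g hg η x0 hK hgK ⟨j, hj⟩ h1 h2 h3).2
  obtain ⟨φ, h1, h2, h3⟩ := hdom (k + 1) k.2
  exact (gradSum_dominated_step ν g hg η x0 hK hgK k h1 h2 h3).1

end LocalSGD

section Clients

variable {E : Type*} [NormedAddCommGroup E] [InnerProductSpace ℝ E] {N τ : ℕ}
  {Z : Fin N → Type*} [∀ n, MeasurableSpace (Z n)]

/-- Cauchy-Schwarz bound for a weighted double sum of vectors. -/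
lemma norm_sq_sum_smul_sum_le (c : Fin N → ℝ) (v : Fin N → Fin τ → E) :
    ‖∑ n, c n • ∑ i, v n i‖ ^ 2 ≤ N * τ * ∑ n, c n ^ 2 * ∑ i, ‖v n i‖ ^ 2 := by
  calc ‖∑ n, c n • ∑ i, v n i‖ ^ 2
      ≤ (∑ n, ‖c n • ∑ i, v n i‖) ^ 2 := by
        gcongr
        exact norm_sum_le _ _
    _ ≤ N * ∑ n, ‖c n • ∑ i, v n i‖ ^ 2 := by
        simpa using sq_sum_le_card_mul_sum_sq (s := Finset.univ)
          (f := fun n => ‖c n • ∑ i, v n i‖)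
    _ ≤ N * ∑ n, c n ^ 2 * (τ * ∑ i, ‖v n i‖ ^ 2) := by
        gcongr with n _
        rw [norm_smul, mul_pow, Real.norm_eq_abs, sq_abs]
        gcongr
        calc ‖∑ i, v n i‖ ^ 2 ≤ (∑ i, ‖v n i‖) ^ 2 := by
              gcongr
              exact norm_sum_le _ _
          _ ≤ τ * ∑ i, ‖v n i‖ ^ 2 := by
              simpa using sq_sum_le_card_mul_sum_sq (s := Finset.univ) (f := fun i => ‖v n i‖)
    _ = N * τ * ∑ n, c n ^ 2 * ∑ i, ‖v n i‖ ^ 2 := by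
        rw [mul_assoc, Finset.mul_sum (a := (τ : ℝ))]
        congr 1
        exact Finset.sum_congr rfl fun n _ => by ring

/-- Weighted sum over all clients and steps of squared gradient norms, where for client `n` only
the first `κ n` steps enter with their actual norm and the others with the bound `K`. -/
noncomputable def hybridSum (g : ∀ n, E → Z n → E) (η : ℝ) (x0 : E) (K : ENNReal) (c : Fin N → ℝ)
    (κ : Fin N → ℕ) (ω : ∀ n, Fin τ → Z n) : ENNReal :=
  ∑ n, ENNReal.ofReal (c n ^ 2) * ∑ i : Fin τ,
    if (i : ℕ) < κ n then ENNReal.ofReal (‖g n (localSGD (g n) η x0 (ω n) i) (ω n i)‖ ^ 2) else K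

/-- If the squared norm of a combination of client gradient sums is integrable, then each client
with nonzero coefficient has a gradient sum dominated in square by an integrable function. -/
lemma exists_gradSum_dominated (ν : ∀ n, Measure (Z n)) [∀ n, IsProbabilityMeasure (ν n)]
    (s : ∀ n, (Fin τ → Z n) → E) (c : Fin N → ℝ)
    (hintegrable : Integrable (fun ω : ∀ n, Fin τ → Z n => ‖∑ n, c n • s n (ω n)‖ ^ 2)
      (Measure.pi fun n => Measure.pi fun _ : Fin τ => ν n)) (n : Fin N) (hc : c n ≠ 0) :
    ∃ φ : (Fin τ → Z n) → ENNReal, Measurable φ ∧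
      ∫⁻ y, φ y ∂(Measure.pi fun _ : Fin τ => ν n) ≠ ⊤ ∧
      ∀ᵐ y ∂(Measure.pi fun _ : Fin τ => ν n), ENNReal.ofReal (‖s n y‖ ^ 2) ≤ φ y := by
  have hmp := measurePreserving_update (fun n => Measure.pi fun _ : Fin τ => ν n) n
  have hf := hintegrable.aestronglyMeasurable.aemeasurable.ennreal_ofReal
  set ψ := hf.mk _
  have hψ : Measurable ψ := hf.measurable_mk
  have hψm := hψ.comp hmp.measurable
  have hfin : ∫⁻ ω, ψ ω ∂(Measure.pi fun n => Measure.pi fun _ : Fin τ => ν n) ≠ ⊤ := by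
    rw [← lintegral_congr_ae hf.ae_eq_mk]
    exact hintegrable.lintegral_lt_top.ne
  have hiter : ∫⁻ ω, ∫⁻ y, ψ (Function.update ω n y) ∂(Measure.pi fun _ : Fin τ => ν n)
      ∂(Measure.pi fun n => Measure.pi fun _ : Fin τ => ν n) ≠ ⊤ := by
    rw [← hmp.lintegral_comp hψ] at hfin
    exact (lintegral_prod _ hψm.aemeasurable).symm.trans_ne hfin
  have hlt := ae_lt_top hψm.lintegral_prod_right' hiter
  have hae := Measure.ae_ae_of_ae_prod (hmp.quasiMeasurePreserving.ae hf.ae_eq_mk)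
  obtain ⟨ω, h1, h2⟩ := (hlt.and hae).exists
  set w : E := ∑ m ∈ Finset.univ.erase n, c m • s m (ω m) with hw
  refine ⟨fun y => ENNReal.ofReal ((c n ^ 2)⁻¹) *
    (2 * ψ (Function.update ω n y) + 2 * ENNReal.ofReal (‖w‖ ^ 2)), ?_, ?_, ?_⟩
  · exact (((hψ.comp (measurable_update ω)).const_mul 2).add_const _).const_mul _
  · rw [lintegral_const_mul' _ _ (by simp), lintegral_add_right _ measurable_const,
      lintegral_const_mul' _ _ (by simp)]
    have h1' := h1.ne
    simp only [Function.comp_apply] at h1'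
    simp [ENNReal.mul_eq_top, h1']
  · filter_upwards [h2] with y hy
    have hsplit : ∑ m, c m • s m (Function.update ω n y m) = w + c n • s n y := by
      rw [← Finset.sum_erase_add _ _ (Finset.mem_univ n), Function.update_self, hw]
      congr 1
      refine Finset.sum_congr rfl fun m hm => ?_
      rw [Function.update_of_ne (Finset.ne_of_mem_erase hm)]
    rw [hsplit] at hy
    have hcs : ‖s n y‖ ^ 2 = (c n ^ 2)⁻¹ * ‖c n • s n y‖ ^ 2 := by
      rw [norm_smul, mul_pow, Real.norm_eq_abs, sq_abs]
      field_simp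
    rw [hcs, ENNReal.ofReal_mul (by positivity)]
    gcongr
    refine (ofReal_norm_sq_le_of_add w _).trans ?_
    rw [hy]

variable [MeasurableSpace E] [BorelSpace E]

lemma lintegral_hybridSum_update_le (ν : ∀ n, Measure (Z n)) [∀ n, IsProbabilityMeasure (ν n)]
    (g : ∀ n, E → Z n → E) (hg : ∀ n x, Measurable (g n x)) (η : ℝ) (x0 : E) {K : ENNReal}
    (c : Fin N → ℝ) (κ : Fin N → ℕ) (n : Fin N) (k : Fin τ) (hk : κ n = k + 1)
    (ω : ∀ n, Fin τ → Z n)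
    (hω : c n ≠ 0 →
      ∫⁻ z, ENNReal.ofReal (‖g n (localSGD (g n) η x0 (ω n) k) z‖ ^ 2) ∂(ν n) ≤ K) :
    ∫⁻ z, hybridSum g η x0 K c κ (Function.update ω n (Function.update (ω n) k z)) ∂(ν n)
      ≤ hybridSum g η x0 K c (Function.update κ n k) ω := by
  have hsq : ∀ x, Measurable fun z => ENNReal.ofReal (‖g n x z‖ ^ 2) := fun x =>
    ((hg n x).norm.pow_const 2).ennreal_ofReal
  let t : Fin N → Fin τ → Z n → ENNReal := fun m i z =>
    if m = n ∧ i = k then ENNReal.ofReal (‖g n (localSGD (g n) η x0 (ω n) k) z‖ ^ 2) else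
      if (i : ℕ) < κ m then
        ENNReal.ofReal (‖g m (localSGD (g m) η x0 (ω m) i) (ω m i)‖ ^ 2) else K
  have ht : ∀ m i, Measurable (t m i) := by
    intro m i
    by_cases h : m = n ∧ i = k
    · simpa only [t, if_pos h] using hsq _
    · simp only [t, if_neg h]
      exact measurable_const
  have hrepr : ∀ z, hybridSum g η x0 K c κ
      (Function.update ω n (Function.update (ω n) k z))
        = ∑ m, ENNReal.ofReal (c m ^ 2) * ∑ i, t m i z := by
    intro z
    unfold hybridSum
    refine Finset.sum_congr rfl fun m _ => ?_
    congr 1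
    refine Finset.sum_congr rfl fun i _ => ?_
    by_cases hm : m = n
    · subst hm
      by_cases hi : i = k
      · subst hi
        simp [t, hk, localSGD_update]
      · simp only [t, hi, and_false, if_false, Function.update_self]
        by_cases hlt : (i : ℕ) < κ m
        · rw [if_pos hlt, if_pos hlt, localSGD_update _ _ _ _ _ _ (by omega),
            Function.update_of_ne hi]
        · rw [if_neg hlt, if_neg hlt]
    · simp [t, hm]
  simp_rw [hrepr]
  rw [lintegral_finsetSum _ fun m _ =>
    (Finset.measurable_fun_sum _ fun i _ => ht m i).const_mul _]
  unfold hybridSum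
  refine Finset.sum_le_sum fun m _ => ?_
  rw [lintegral_const_mul' _ _ (by simp), lintegral_finsetSum _ fun i _ => ht m i]
  by_cases hc : c m = 0
  · simp [hc]
  gcongr with i _
  by_cases hm : m = n
  · subst hm
    by_cases hi : i = k
    · subst hi
      simpa [t] using hω hc
    · have hne : (i : ℕ) ≠ k := fun h => hi (Fin.ext h)
      have hiff : (i : ℕ) < κ m ↔ (i : ℕ) < k := by omega
      simp [t, hi, hiff]
  · simp [t, hm]

/-- If the oracle almost surely has second moment at most `K` along the iterates, then the expected
hybrid sum is at most its deterministic version. -/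
lemma lintegral_hybridSum_le (ν : ∀ n, Measure (Z n)) [∀ n, IsProbabilityMeasure (ν n)]
    (g : ∀ n, E → Z n → E) (hg : ∀ n x, Measurable (g n x)) (η : ℝ) (x0 : E) {K : ENNReal}
    (c : Fin N → ℝ)
    (hmom : ∀ n, c n ≠ 0 → ∀ k : Fin τ, ∀ᵐ y ∂(Measure.pi fun _ : Fin τ => ν n),
      ∫⁻ z, ENNReal.ofReal (‖g n (localSGD (g n) η x0 y k) z‖ ^ 2) ∂(ν n) ≤ K)
    (κ : Fin N → ℕ) (hκ : ∀ n, κ n ≤ τ) :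
    ∫⁻ ω, hybridSum g η x0 K c κ ω ∂(Measure.pi fun n => Measure.pi fun _ : Fin τ => ν n)
      ≤ ∑ n, ENNReal.ofReal (c n ^ 2) * (τ * K) := by
  induction hs : ∑ n, κ n generalizing κ with
  | zero =>
    have h0 : ∀ n, κ n = 0 := by simpa using hs
    simp [hybridSum, h0]
  | succ s ih =>
    obtain ⟨n, hn⟩ : ∃ n, κ n ≠ 0 := by
      by_contra! h
      simp [h] at hs
    obtain ⟨k, hk⟩ := Nat.exists_eq_succ_of_ne_zero hn
    have hkτ : k < τ := by have := hκ n; omega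
    have hmp := measurePreserving_update_update ν n (⟨k, hkτ⟩ : Fin τ)
    have hsum : ∑ m, Function.update κ n k m = s := by
      have hrest : ∑ m ∈ Finset.univ.erase n, Function.update κ n k m
          = ∑ m ∈ Finset.univ.erase n, κ m :=
        Finset.sum_congr rfl fun m hm => Function.update_of_ne (Finset.ne_of_mem_erase hm) k κ
      rw [← Finset.sum_erase_add _ _ (Finset.mem_univ n)] at hs ⊢
      rw [Function.update_self, hrest]
      omega
    refine le_trans ?_ (ih (Function.update κ n k) (fun m => ?_) hsum)
    · conv_lhs => rw [← hmp.map_eq]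
      refine (lintegral_map_le _ _).trans ((lintegral_prod_le _).trans ?_)
      refine lintegral_mono_ae ?_
      have hae : ∀ᵐ ω ∂(Measure.pi fun n => Measure.pi fun _ : Fin τ => ν n), c n ≠ 0 →
          ∫⁻ z, ENNReal.ofReal
            (‖g n (localSGD (g n) η x0 (ω n) (⟨k, hkτ⟩ : Fin τ)) z‖ ^ 2) ∂(ν n) ≤ K := by
        by_cases hc : c n = 0
        · simp [hc]
        · filter_upwards [(measurePreserving_eval
            (fun n => Measure.pi fun _ : Fin τ => ν n) n).quasiMeasurePreserving.ae
            (hmom n hc ⟨k, hkτ⟩)] with ω hω _ using hω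
      filter_upwards [hae] with ω hω
      exact lintegral_hybridSum_update_le ν g hg η x0 c κ n ⟨k, hkτ⟩ hk ω hω
    · by_cases hm : m = n
      · subst hm
        simpa using hkτ.le
      · simpa [hm] using hκ m

/-- Second moment bound for a combination of client gradient sums. -/
lemma integral_norm_sq_sum_gradSum_le (ν : ∀ n, Measure (Z n)) [∀ n, IsProbabilityMeasure (ν n)]
    (g : ∀ n, E → Z n → E) (hg : ∀ n x, Measurable (g n x)) (η : ℝ) (x0 : E) (G : ℝ)
    (hsecond : ∀ n x, ∫ z, ‖g n x z‖ ^ 2 ∂(ν n) ≤ G ^ 2) (c : Fin N → ℝ)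
    (hintegrable : Integrable (fun ω : ∀ n, Fin τ → Z n => ‖∑ n, c n • gradSum (g n) η x0 τ (ω n)‖ ^ 2)
      (Measure.pi fun n => Measure.pi fun _ : Fin τ => ν n)) :
    ∫ ω : ∀ n, Fin τ → Z n, ‖∑ n, c n • gradSum (g n) η x0 τ (ω n)‖ ^ 2
        ∂(Measure.pi fun n => Measure.pi fun _ : Fin τ => ν n)
      ≤ N * (τ : ℝ) ^ 2 * G ^ 2 * ∑ n, c n ^ 2 := by
  have hgK : ∀ n x, ∫⁻ z, ENNReal.ofReal (‖g n x z‖ ^ 2) ∂(ν n) ≠ ⊤ →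
      ∫⁻ z, ENNReal.ofReal (‖g n x z‖ ^ 2) ∂(ν n) ≤ ENNReal.ofReal (G ^ 2) := by
    intro n x hx
    have hi : Integrable (fun z => ‖g n x z‖ ^ 2) (ν n) :=
      (lintegral_ofReal_ne_top_iff_integrable
        ((hg n x).norm.pow_const 2).aestronglyMeasurable
        (Filter.Eventually.of_forall fun _ => by positivity)).1 hx
    rw [← ofReal_integral_eq_lintegral_ofReal hi
      (Filter.Eventually.of_forall fun _ => by positivity)]
    exact ENNReal.ofReal_le_ofReal (hsecond n x)
  have hmom : ∀ n, c n ≠ 0 → ∀ k : Fin τ, ∀ᵐ y ∂(Measure.pi fun _ : Fin τ => ν n),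
      ∫⁻ z, ENNReal.ofReal (‖g n (localSGD (g n) η x0 y k) z‖ ^ 2) ∂(ν n)
        ≤ ENNReal.ofReal (G ^ 2) := by
    intro n hc k
    obtain ⟨φ, h1, h2, h3⟩ :=
      exists_gradSum_dominated ν (fun n => gradSum (g n) η x0 τ) c hintegrable n hc
    filter_upwards [ae_secondMoment_ne_top (ν n) (g n) (hg n) η x0 ENNReal.ofReal_ne_top
      (hgK n) h1 h2 h3 k] with y hy using hgK n _ hy
  rw [integral_eq_lintegral_of_nonneg_ae (Filter.Eventually.of_forall fun _ => by positivity)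
    hintegrable.aestronglyMeasurable]
  refine ENNReal.toReal_le_of_le_ofReal (by positivity) ?_
  calc ∫⁻ ω : ∀ n, Fin τ → Z n,
        ENNReal.ofReal (‖∑ n, c n • gradSum (g n) η x0 τ (ω n)‖ ^ 2)
          ∂(Measure.pi fun n => Measure.pi fun _ : Fin τ => ν n)
      ≤ ∫⁻ ω : ∀ n, Fin τ → Z n, ENNReal.ofReal (N * τ) *
          hybridSum g η x0 (ENNReal.ofReal (G ^ 2)) c (fun _ => τ) ω
          ∂(Measure.pi fun n => Measure.pi fun _ : Fin τ => ν n) := by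
        refine lintegral_mono fun ω => ?_
        simp only [gradSum_self]
        refine (ENNReal.ofReal_le_ofReal (norm_sq_sum_smul_sum_le c _)).trans_eq ?_
        rw [ENNReal.ofReal_mul (by positivity),
          ENNReal.ofReal_sum_of_nonneg fun _ _ => by positivity]
        congr 1
        refine Finset.sum_congr rfl fun n _ => ?_
        rw [ENNReal.ofReal_mul (by positivity),
          ENNReal.ofReal_sum_of_nonneg fun _ _ => by positivity]
        simp
    _ ≤ ENNReal.ofReal (N * τ) *
          ∑ n, ENNReal.ofReal (c n ^ 2) * (τ * ENNReal.ofReal (G ^ 2)) := by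
        rw [lintegral_const_mul' _ _ ENNReal.ofReal_ne_top]
        gcongr
        exact lintegral_hybridSum_le ν g hg η x0 c hmom _ fun _ => le_rfl
    _ = ENNReal.ofReal (N * (τ : ℝ) ^ 2 * G ^ 2 * ∑ n, c n ^ 2) := by
        rw [← Finset.sum_mul, ← ENNReal.ofReal_sum_of_nonneg fun _ _ => by positivity,
          ← ENNReal.ofReal_natCast τ, ← ENNReal.ofReal_mul (by positivity),
          ← ENNReal.ofReal_mul (Finset.sum_nonneg fun _ _ => by positivity),
          ← ENNReal.ofReal_mul (by positivity)]
        congr 1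
        ring

end Clients

/-- Second moment of the normalised participation noise of one client. -/
lemma integral_participation_sq_le {Ω : Type*} [MeasurableSpace Ω] (μ : Measure Ω)
    [IsProbabilityMeasure μ] (J : Ω → ℝ) (hJ : Measurable J) (hJ01 : ∀ ω, J ω = 0 ∨ J ω = 1)
    (q : ℝ) (hq : 0 < q) (hJq : μ {ω | J ω = 1} = ENNReal.ofReal q) :
    Integrable (fun ω => (J ω / q - 1) ^ 2) μ ∧ ∫ ω, (J ω / q - 1) ^ 2 ∂μ ≤ 1 / q := by
  have hset : MeasurableSet {ω | J ω = 1} := hJ (measurableSet_singleton 1)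
  have hind : ∀ ω, (J ω / q - 1) ^ 2
      = {ω | J ω = 1}.indicator (fun _ => (1 / q) ^ 2 - 2 / q) ω + 1 := by
    intro ω
    rcases hJ01 ω with h | h
    · simp [h]
    · simp [h]
      ring
  have hi : Integrable ({ω | J ω = 1}.indicator fun _ => (1 / q) ^ 2 - 2 / q) μ :=
    (integrable_const _).indicator hset
  simp_rw [hind]
  refine ⟨hi.add (integrable_const 1), ?_⟩
  rw [integral_add hi (integrable_const 1), integral_indicator_const _ hset, Measure.real, hJq,
    ENNReal.toReal_ofReal hq.le]
  simp only [integral_const, probReal_univ, smul_eq_mul, mul_one]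
  have : q * ((1 / q) ^ 2 - 2 / q) + 1 = 1 / q - 1 := by
    field_simp
    ring
  linarith



/-- Deviation between partial-participation and full-participation aggregates
(the bound (eq. server-strong-partial-1)). -/
theorem stmt_14 {E : Type*} [NormedAddCommGroup E] [InnerProductSpace ℝ E] [CompleteSpace E]
    [MeasurableSpace E] [BorelSpace E]
    (N : ℕ) {Z : Fin N → Type*} [∀ n, MeasurableSpace (Z n)]
    (ν : ∀ n, Measure (Z n)) [∀ n, IsProbabilityMeasure (ν n)]
    {ΩI : Type*} [MeasurableSpace ΩI] (μI : Measure ΩI) [IsProbabilityMeasure μI]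
    (F : Fin N → E → ℝ) (S : ℝ) (σ : Fin N → ℝ) (G : ℝ)
    (hdiff : ∀ n, Differentiable ℝ (F n))
    (hlip : ∀ n (a b : E), ‖gradient (F n) a - gradient (F n) b‖ ≤ S * ‖a - b‖)
    (g : ∀ n, E → Z n → E) (hgmeas : ∀ n, Measurable (Function.uncurry (g n)))
    (hmean : ∀ n (a : E), ∫ z, g n a z ∂(ν n) = gradient (F n) a)
    (hvar : ∀ n (a : E), ∫ z, ‖g n a z - gradient (F n) a‖ ^ 2 ∂(ν n) ≤ (σ n) ^ 2)
    (hsecond : ∀ n (a : E), ∫ z, ‖g n a z‖ ^ 2 ∂(ν n) ≤ G ^ 2)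
    (a : Fin N → ℝ) (ha : ∀ n, 0 ≤ a n) (hsum : ∑ n, a n = 1)
    (I : ΩI → Fin N → ℝ) (hImeas : ∀ n, Measurable fun ωI => I ωI n)
    (hI01 : ∀ ωI n, I ωI n = 0 ∨ I ωI n = 1)
    (q : Fin N → ℝ) (hq : ∀ n, 0 < q n ∧ q n ≤ 1)
    (hIq : ∀ n, μI {ωI | I ωI n = 1} = ENNReal.ofReal (q n))
    (τ : ℕ) (η : ℝ) (hη : 0 ≤ η)
    (x0 : E) (X : Fin N → ℕ → ((n : Fin N) → Fin τ → Z n) → E)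
    (hX0 : ∀ n ω, X n 0 ω = x0)
    (hXrec : ∀ n (i : ℕ) (hi : i < τ) ω,
      X n (i + 1) ω = X n i ω - η • g n (X n i ω) (ω n ⟨i, hi⟩)) :
    ∫ p : ((n : Fin N) → Fin τ → Z n) × ΩI,
        ‖η • ∑ n, (a n * (I p.2 n / q n - 1)) •
            ∑ i : Fin τ, g n (X n i.1 p.1) (p.1 n i)‖ ^ 2
        ∂((Measure.pi fun n => Measure.pi fun _ : Fin τ => ν n).prod μI) ≤
      N * (τ : ℝ) ^ 2 * η ^ 2 * G ^ 2 * ∑ n, (a n) ^ 2 / q n := by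
  have hXeq : ∀ n ω, ∀ k ≤ τ, X n k ω = localSGD (g n) η x0 (ω n) k := by
    intro n ω k hk
    induction k with
    | zero => exact hX0 n ω
    | succ k ih =>
      have hkτ : k < τ := hk
      rw [hXrec n k hkτ ω, ih hkτ.le]
      simp [localSGD, hkτ]
  have hsum_eq : ∀ p : ((n : Fin N) → Fin τ → Z n) × ΩI,
      ‖η • ∑ n, (a n * (I p.2 n / q n - 1)) •
          ∑ i : Fin τ, g n (X n i.1 p.1) (p.1 n i)‖ ^ 2
        = ‖∑ n, (η * (a n * (I p.2 n / q n - 1))) • gradSum (g n) η x0 τ (p.1 n)‖ ^ 2 := by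
    intro p
    simp_rw [gradSum_self, Finset.smul_sum (r := η), smul_smul η]
    simp only [fun n (i : Fin τ) => hXeq n p.1 i i.2.le]
  simp_rw [hsum_eq]
  have hrhs : 0 ≤ N * (τ : ℝ) ^ 2 * η ^ 2 * G ^ 2 * ∑ n, (a n) ^ 2 / q n :=
    mul_nonneg (by positivity)
      (Finset.sum_nonneg fun n _ => div_nonneg (sq_nonneg _) (hq n).1.le)
  by_cases hintegrable : Integrable (fun p : ((n : Fin N) → Fin τ → Z n) × ΩI =>
      ‖∑ n, (η * (a n * (I p.2 n / q n - 1))) • gradSum (g n) η x0 τ (p.1 n)‖ ^ 2)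
      ((Measure.pi fun n => Measure.pi fun _ : Fin τ => ν n).prod μI)
  swap
  · rwa [integral_undef hintegrable]
  have hnoise := fun n => integral_participation_sq_le μI (fun ωI => I ωI n) (hImeas n)
    (fun ωI => hI01 ωI n) (q n) (hq n).1 (hIq n)
  have hterm : ∀ n, Integrable (fun ωI => (η * (a n * (I ωI n / q n - 1))) ^ 2) μI := by
    intro n
    simp_rw [mul_pow]
    exact ((hnoise n).1.const_mul _).const_mul _
  rw [integral_prod_symm _ hintegrable]
  calc _ ≤ ∫ ωI, N * (τ : ℝ) ^ 2 * G ^ 2 *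
          ∑ n, (η * (a n * (I ωI n / q n - 1))) ^ 2 ∂μI := by
        refine integral_mono_ae hintegrable.integral_prod_right
          ((integrable_finsetSum _ fun n _ => hterm n).const_mul _) ?_
        filter_upwards [hintegrable.prod_left_ae] with ωI hωI
        exact integral_norm_sq_sum_gradSum_le ν g (fun n x => (hgmeas n).of_uncurry_left) η x0 G
          hsecond _ hωI
    _ = N * (τ : ℝ) ^ 2 * G ^ 2 * ∑ n, η ^ 2 * (a n ^ 2 *
          ∫ ωI, (I ωI n / q n - 1) ^ 2 ∂μI) := by
        rw [integral_const_mul, integral_finsetSum _ fun n _ => hterm n]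
        simp_rw [mul_pow, integral_const_mul]
    _ ≤ N * (τ : ℝ) ^ 2 * G ^ 2 * ∑ n, η ^ 2 * (a n ^ 2 * (1 / q n)) := by
        gcongr with n _
        exact (hnoise n).2
    _ = N * (τ : ℝ) ^ 2 * η ^ 2 * G ^ 2 * ∑ n, (a n) ^ 2 / q n := by
        rw [← Finset.mul_sum]
        simp_rw [mul_one_div]
        ring
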